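/- Let ℓ be a 1-Lipschitz function with ℓ(0) = 0 and ℓ_σ = ℓ ∗ φ_σ its Gaussian smoothing. Then there exists a polynomial P_{k−1}(θ) = Σ_{x=0}^{k−1} c_x θ^x whose coefficients satisfy |c_x| ≤ C(θ*, σ²)(x+1)^{1/2} 2^x (1 + (x/(eσ²))^{x/2}) / x!, such that sup over θ ∈ [0, θ*] of |ℓ_σ(θ) − ℓ_σ(0) − e^{−θ}P_{k−1}(θ)| ≤ C(θ*, σ²)(k+1)^{1/2}(2θ*)^k (1 + (k/(eσ²))^{k/2}) / k!, for a constant C(θ*, σ²) > 0 depending only on θ* and σ². -/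

import Mathlib

open MeasureTheory Real

noncomputable section

/-- The density of `N(0, σ²)`. -/
def gaussPDF (σ : ℝ) (y : ℝ) : ℝ :=
  Real.exp (-(y ^ 2) / (2 * σ ^ 2)) / (σ * Real.sqrt (2 * Real.pi))

/-- Gaussian smoothing `ℓ_σ = ℓ ∗ φ_σ` of a function `ℓ`. -/
def smooth (σ : ℝ) (l : ℝ → ℝ) (θ : ℝ) : ℝ := ∫ y, l (θ - y) * gaussPDF σ y

lemma fact_le (k : ℕ) (hk : 1 ≤ k) :
    (Nat.factorial k : ℝ) ≤ exp 1 * √k * ((k:ℝ) ^ k * exp (-k)) := by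
  obtain ⟨n, rfl⟩ : ∃ n, k = n + 1 := ⟨k - 1, by omega⟩
  have h := Stirling.stirlingSeq'_antitone (Nat.zero_le n)
  simp only [Function.comp, Nat.succ_eq_add_one, zero_add, Stirling.stirlingSeq_one] at h
  rw [Stirling.stirlingSeq, div_le_iff₀ (by positivity)] at h
  refine h.trans (le_of_eq ?_)
  rw [Real.sqrt_mul (by norm_num), div_pow, ← Real.exp_nat_mul, mul_one, Real.exp_neg]
  have : √(2:ℝ) ≠ 0 := by positivity
  field_simp

lemma numeric (θs σ E : ℝ) (hθ : 0 < θs) (hσ : 0 < σ) (hE : 0 ≤ E) :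
    ∃ C > (0:ℝ), ∀ k : ℕ, 1 ≤ k → ∃ r : ℝ, 0 < r ∧ 2 * θs ≤ r ∧
      2 * (exp r * (exp (r ^ 2 / (2 * σ ^ 2)) * (r + 2 * E))) / r ^ k ≤
       C * √(k + 1) * 2 ^ k * (1 + ((k : ℝ) / (exp 1 * σ ^ 2)) ^ ((k : ℝ) / 2)) /
          (Nat.factorial k) := by
  set α := 2 * σ + 2 * θs / σ + 1 with hα
  set β := 4 * θs + 2 * E + 2 * θs ^ 2 / σ ^ 2 + 1 with hβ
  refine ⟨2 * exp (β + α ^ 2), by positivity, fun k hk => ?_⟩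
  have hk' : (1:ℝ) ≤ k := by exact_mod_cast hk
  have hs : 0 < √(k:ℝ) := by positivity
  have hss : √(k:ℝ) ^ 2 = k := Real.sq_sqrt (by positivity)
  set s := √(k:ℝ) with hs_def
  refine ⟨σ * s + 2 * θs, by positivity, by nlinarith [mul_pos hσ hs], ?_⟩
  set r := σ * s + 2 * θs with hr
  have hrpos : 0 < r := by positivity
  have hq : ((k : ℝ) / (exp 1 * σ ^ 2)) ^ ((k : ℝ) / 2) = (s / (σ * exp (1/2))) ^ k := by
    have : (k : ℝ) / (exp 1 * σ ^ 2) = (s / (σ * exp (1/2))) ^ (2:ℝ) := by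
      rw [Real.rpow_two, div_pow, mul_pow, hss, ← Real.exp_nat_mul]
      norm_num
      ring
    rw [this, ← Real.rpow_mul (by positivity), ← Real.rpow_natCast]
    congr 1; ring
  rw [hq]
  have hM : exp r * (exp (r ^ 2 / (2 * σ ^ 2)) * (r + 2 * E)) ≤
      exp (2 * r + 2 * E + r ^ 2 / (2 * σ ^ 2)) := by
    have h1 : r + 2 * E ≤ exp (r + 2 * E) := by linarith [Real.add_one_le_exp (r + 2 * E)]
    calc _ ≤ exp r * (exp (r ^ 2 / (2 * σ ^ 2)) * exp (r + 2 * E)) := by gcongr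
      _ = _ := by rw [← Real.exp_add, ← Real.exp_add]; congr 1; ring
  have hse : s ≤ exp s := by linarith [Real.add_one_le_exp s]
  have hexp : 2 * r + 2 * E + r ^ 2 / (2 * σ ^ 2) + 1 + s = α * s + β + k / 2 := by
    rw [← hss, hr, hα, hβ]; field_simp; ring
  have h2 : exp (α * s) ≤ exp (α ^ 2) * 2 ^ k := by
    have : (2:ℝ) ^ k = exp (k * Real.log 2) := by
      rw [Real.exp_nat_mul, Real.exp_log (by norm_num)]
    rw [this, ← Real.exp_add]
    apply Real.exp_le_exp.2
    have := Real.log_two_gt_d9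
    rw [← hss]
    nlinarith [sq_nonneg (α - s / 2), sq_nonneg s]
  have key : exp r * (exp (r ^ 2 / (2 * σ ^ 2)) * (r + 2 * E)) * Nat.factorial k ≤
      exp (β + α ^ 2) * 2 ^ k * ((k:ℝ) ^ k * exp (- k / 2)) := by
    calc _ ≤ exp (2 * r + 2 * E + r ^ 2 / (2 * σ ^ 2)) *
          (exp 1 * exp s * ((k:ℝ) ^ k * exp (-k))) := by
            gcongr
            exact (fact_le k hk).trans (by gcongr)
      _ = exp (2 * r + 2 * E + r ^ 2 / (2 * σ ^ 2) + 1 + s) * ((k:ℝ) ^ k * exp (-k)) := by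
            rw [Real.exp_add _ s, Real.exp_add _ 1]; ring
      _ = exp (α * s) * exp β * ((k:ℝ) ^ k * exp (-k / 2)) := by
            rw [hexp]
            have : exp (-(k:ℝ)/2) = exp (-k) * exp (k/2) := by
              rw [← Real.exp_add]; congr 1; ring
            rw [this, Real.exp_add, Real.exp_add]; ring
      _ ≤ (exp (α ^ 2) * 2 ^ k) * exp β * ((k:ℝ) ^ k * exp (-k / 2)) := by gcongr
      _ = _ := by rw [Real.exp_add β]; ring
  have hkk : (s / (σ * exp (1/2))) ^ k * (σ * s) ^ k = (k:ℝ) ^ k * exp (-k / 2) := by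
    have : exp (-(k:ℝ)/2) = (exp (-(1/2))) ^ k := by
      rw [← Real.exp_nat_mul]; congr 1; ring
    rw [this, ← mul_pow, ← mul_pow]
    congr 1
    rw [← hss, Real.exp_neg]; field_simp
  have hr2 : (σ * s) ^ k ≤ r ^ k := by gcongr; linarith
  rw [div_le_div_iff₀ (by positivity) (by positivity)]
  have hone : (1:ℝ) ≤ √((k:ℝ) + 1) := Real.one_le_sqrt.2 (by linarith)
  have hq0 : 0 ≤ (s / (σ * exp (1/2))) ^ k := by positivity
  calc _ ≤ 2 * (exp (β + α ^ 2) * 2 ^ k * ((k:ℝ) ^ k * exp (- k / 2))) := by linarith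
    _ = 2 * exp (β + α ^ 2) * 1 * 2 ^ k * (s / (σ * exp (1/2))) ^ k * (σ * s) ^ k := by
        rw [← hkk]; ring
    _ ≤ _ := by gcongr; linarith

lemma taylor_tail (f : ℂ → ℂ) (hf : Differentiable ℂ f) (r M : ℝ) (hr : 0 < r)
    (hM : ∀ z : ℂ, ‖z‖ = r → ‖f z‖ ≤ M) :
    (∀ n, ‖iteratedDeriv n f 0 / (Nat.factorial n)‖ ≤ M / r ^ n) ∧
    ∀ s : ℝ, 0 ≤ s → 2 * s ≤ r → ∀ z : ℂ, ‖z‖ ≤ s → ∀ k : ℕ,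
      ‖f z - ∑ n ∈ Finset.range k, iteratedDeriv n f 0 / (Nat.factorial n) * z ^ n‖ ≤
        2 * M / r ^ k * s ^ k := by
  have h1 : ∀ n, ‖iteratedDeriv n f 0 / (Nat.factorial n)‖ ≤ M / r ^ n := by
    intro n
    have := Complex.norm_iteratedDeriv_le_of_forall_mem_sphere_norm_le (c := 0) (f := f) n hr
      hf.diffContOnCl (C := M) (fun z hz => hM z (by simpa using hz))
    rw [norm_div, Complex.norm_natCast, div_le_iff₀ (by positivity)]
    calc _ ≤ _ := this
      _ = _ := by ring
  refine ⟨h1, fun s hs hsr z hz k => ?_⟩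
  have hM0 : 0 ≤ M := (norm_nonneg _).trans (hM r (by simp [abs_of_pos hr]))
  have hsum := Complex.hasSum_taylorSeries_of_entire hf 0 z
  have hsum' : HasSum (fun n => iteratedDeriv n f 0 / (Nat.factorial n) * z ^ n) (f z) := by
    have he : (fun n => iteratedDeriv n f 0 / (Nat.factorial n : ℂ) * z ^ n) =
        fun n : ℕ => ((Nat.factorial n : ℂ))⁻¹ • (z - 0) ^ n • iteratedDeriv n f 0 := by
      funext n
      simp only [smul_eq_mul, sub_zero]; ring
    rw [he]; exact hsum
  have htail := (hasSum_nat_add_iff' k).2 hsum'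
  rw [← htail.tsum_eq]
  have hg : HasSum (fun n : ℕ => M / r ^ k * s ^ k * (1/2:ℝ) ^ n) (M / r ^ k * s ^ k * 2) :=
    hasSum_geometric_two.mul_left _
  refine (tsum_of_norm_bounded hg fun n => ?_).trans (le_of_eq (by ring))
  rw [norm_mul, norm_pow]
  calc _ ≤ M / r ^ (n + k) * s ^ (n + k) := by gcongr; exact h1 _
    _ = M / r ^ k * s ^ k * (s / r) ^ n := by rw [pow_add, pow_add, div_pow]; field_simp
    _ ≤ _ := by
      have : s / r ≤ 1 / 2 := by rw [div_le_div_iff₀ hr (by norm_num)]; linarith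
      gcongr M / r ^ k * s ^ k * ?_ ^ n

lemma gauss_pos (σ : ℝ) (hσ : 0 < σ) (u : ℝ) : 0 < gaussPDF σ u := by
  unfold gaussPDF; positivity

lemma gauss_cont (σ : ℝ) : Continuous (gaussPDF σ) := by
  unfold gaussPDF; fun_prop

lemma gauss_even (σ u : ℝ) : gaussPDF σ (-u) = gaussPDF σ u := by
  simp [gaussPDF]

lemma gauss_total (σ : ℝ) (hσ : 0 < σ) : ∫ u, gaussPDF σ u = 1 := by
  have h := integral_gaussian (1 / (2 * σ ^ 2))
  have : ∀ u, gaussPDF σ u = exp (-(1 / (2 * σ ^ 2)) * u ^ 2) / (σ * √(2 * π)) := by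
    intro u; unfold gaussPDF; congr 2; ring
  simp_rw [this]
  rw [integral_div, h]
  have : π / (1 / (2 * σ ^ 2)) = σ ^ 2 * (2 * π) := by field_simp
  rw [this, Real.sqrt_mul (by positivity), Real.sqrt_sq hσ.le]
  exact div_self (by positivity)

lemma int_exp (σ : ℝ) (hσ : 0 < σ) (a : ℝ) :
    Integrable (fun u => exp (a * |u|) * gaussPDF σ u) := by
  have hi := (integrable_exp_neg_mul_sq (b := 1 / (4 * σ ^ 2)) (by positivity)).const_mul
    (exp (a ^ 2 * σ ^ 2) / (σ * √(2 * π)))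
  refine hi.mono' ?_ (Filter.Eventually.of_forall fun u => ?_)
  · exact (Continuous.mul (by fun_prop) (gauss_cont σ)).aestronglyMeasurable
  · have := gauss_pos σ hσ u
    rw [Real.norm_eq_abs, abs_of_pos (by positivity), gaussPDF, ← mul_div_assoc, ← Real.exp_add,
      div_mul_eq_mul_div, ← Real.exp_add]
    refine div_le_div_of_nonneg_right (Real.exp_le_exp.2 ?_) (by positivity)
    have h2 : 0 ≤ (a * σ - |u| / (2 * σ)) ^ 2 := sq_nonneg _
    have h3 : (a * σ - |u| / (2 * σ)) ^ 2 = a ^ 2 * σ ^ 2 - a * |u| + u ^ 2 / (4 * σ ^ 2) := by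
      rw [sub_sq, div_pow, sq_abs]; field_simp; ring
    have h4 : -u ^ 2 / (2 * σ ^ 2) = - (u ^ 2 / (4 * σ ^ 2)) - u ^ 2 / (4 * σ ^ 2) := by
      field_simp; ring
    have h5 : -(1 / (4 * σ ^ 2)) * u ^ 2 = - (u ^ 2 / (4 * σ ^ 2)) := by ring
    rw [h4, h5]; linarith

def Jc (σ : ℝ) (l : ℝ → ℝ) (z : ℂ) : ℂ :=
  ∫ u : ℝ, Complex.exp (z * u / σ ^ 2) * ((l u * gaussPDF σ u : ℝ) : ℂ)

def Hc (σ : ℝ) (l : ℝ → ℝ) (z : ℂ) : ℂ :=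
  Complex.exp (-z ^ 2 / (2 * σ ^ 2)) * Jc σ l z

lemma lip_abs {l : ℝ → ℝ} (hl : LipschitzWith 1 l) (h0 : l 0 = 0) (u : ℝ) : |l u| ≤ |u| := by
  have := hl.dist_le_mul u 0
  simpa [Real.dist_eq, h0] using this

lemma norm_kernel (σ : ℝ) (z : ℂ) (u : ℝ) :
    ‖Complex.exp (z * u / σ ^ 2)‖ = exp (z.re * u / σ ^ 2) := by
  rw [Complex.norm_exp]
  congr 1
  have : z * u / σ ^ 2 = z * ((u / σ ^ 2 : ℝ) : ℂ) := by push_cast; ring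
  rw [this, Complex.re_mul_ofReal]; ring

lemma Jc_diff (σ : ℝ) (hσ : 0 < σ) {l : ℝ → ℝ} (hl : LipschitzWith 1 l) (h0 : l 0 = 0) :
    Differentiable ℂ (Jc σ l) := by
  intro z₀
  have hlc := hl.continuous
  have hgc := gauss_cont σ
  have hk : ∀ z : ℂ, ∀ u : ℝ, ‖z‖ ≤ ‖z₀‖ + 1 →
      ‖Complex.exp (z * u / σ ^ 2)‖ ≤ exp ((‖z₀‖ + 1) / σ ^ 2 * |u|) := by
    intro z u hz
    rw [norm_kernel]
    apply Real.exp_le_exp.2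
    calc z.re * u / σ ^ 2 ≤ |z.re * u| / σ ^ 2 := by gcongr; exact le_abs_self _
      _ = |z.re| * |u| / σ ^ 2 := by rw [abs_mul]
      _ ≤ (‖z₀‖ + 1) * |u| / σ ^ 2 := by
        gcongr; exact (Complex.abs_re_le_norm z).trans hz
      _ = _ := by ring
  have hw : ∀ u, ‖((l u * gaussPDF σ u : ℝ) : ℂ)‖ ≤ exp |u| * gaussPDF σ u := by
    intro u
    have := gauss_pos σ hσ u
    rw [Complex.norm_real, norm_mul, Real.norm_eq_abs, Real.norm_eq_abs, abs_of_pos this]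
    gcongr
    linarith [lip_abs hl h0 u, Real.add_one_le_exp |u|]
  have hmeas : ∀ z : ℂ, AEStronglyMeasurable
      (fun u : ℝ => Complex.exp (z * u / σ ^ 2) * ((l u * gaussPDF σ u : ℝ) : ℂ)) := by
    intro z
    exact Continuous.aestronglyMeasurable (by fun_prop)
  refine (hasDerivAt_integral_of_dominated_loc_of_deriv_le (μ := volume) (𝕜 := ℂ)
    (F := fun (z : ℂ) (u : ℝ) => Complex.exp (z * u / σ ^ 2) * ((l u * gaussPDF σ u : ℝ) : ℂ))
    (F' := fun (z : ℂ) (u : ℝ) => Complex.exp (z * u / σ ^ 2) * (u / σ ^ 2) *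
      ((l u * gaussPDF σ u : ℝ) : ℂ))
    (bound := fun u => 1 / σ ^ 2 * (exp (((‖z₀‖ + 1) / σ ^ 2 + 2) * |u|) * gaussPDF σ u))
    (s := Metric.ball z₀ 1) (x₀ := z₀) (Metric.ball_mem_nhds _ one_pos) ?_ ?_ ?_ ?_ ?_ ?_
    ).2.differentiableAt
  · exact Filter.Eventually.of_forall hmeas
  · refine (int_exp σ hσ ((‖z₀‖ + 1) / σ ^ 2 + 1)).mono' (hmeas _)
      (Filter.Eventually.of_forall fun u => ?_)
    rw [norm_mul]
    calc _ ≤ exp ((‖z₀‖ + 1) / σ ^ 2 * |u|) * (exp |u| * gaussPDF σ u) := by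
          gcongr
          · exact hk _ _ (by linarith)
          · exact hw u
      _ = _ := by rw [add_mul, Real.exp_add, one_mul]; ring
  · exact Continuous.aestronglyMeasurable (by fun_prop)
  · refine Filter.Eventually.of_forall fun u z hz => ?_
    have hz' : ‖z‖ ≤ ‖z₀‖ + 1 := by
      have h1 : ‖z - z₀‖ < 1 := by simpa [dist_eq_norm] using hz
      have h2 := norm_sub_norm_le z z₀
      linarith
    have hu : ‖(u / σ ^ 2 : ℂ)‖ ≤ exp |u| / σ ^ 2 := by
      have : (u / σ ^ 2 : ℂ) = ((u / σ ^ 2 : ℝ) : ℂ) := by push_cast; rfl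
      rw [this, Complex.norm_real, Real.norm_eq_abs, abs_div, abs_of_pos (by positivity : 0 < σ ^ 2)]
      gcongr
      linarith [Real.add_one_le_exp |u|]
    rw [norm_mul, norm_mul]
    calc _ ≤ exp ((‖z₀‖ + 1) / σ ^ 2 * |u|) * (exp |u| / σ ^ 2) * (exp |u| * gaussPDF σ u) := by
          gcongr
          · exact hk _ _ hz'
          · exact hw u
      _ = _ := by rw [add_mul, Real.exp_add, two_mul, Real.exp_add]; ring
  · exact (int_exp σ hσ _).const_mul _
  · refine Filter.Eventually.of_forall fun u z _ => ?_
    have h1 : HasDerivAt (fun z : ℂ => z * u / σ ^ 2) (u / σ ^ 2 : ℂ) z := by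
      simpa using ((hasDerivAt_id z).mul_const (u : ℂ)).div_const ((σ : ℂ) ^ 2)
    exact h1.cexp.mul_const _

lemma Hc_diff (σ : ℝ) (hσ : 0 < σ) {l : ℝ → ℝ} (hl : LipschitzWith 1 l) (h0 : l 0 = 0) :
    Differentiable ℂ (Hc σ l) := by
  have := Jc_diff σ hσ hl h0
  unfold Hc
  fun_prop

lemma gauss_shift (σ : ℝ) (hσ : 0 < σ) (x u : ℝ) :
    exp (-x ^ 2 / (2 * σ ^ 2)) * (exp (x * u / σ ^ 2) * gaussPDF σ u) = gaussPDF σ (x - u) := by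
  unfold gaussPDF
  rw [← mul_div_assoc, ← mul_div_assoc, ← Real.exp_add, ← Real.exp_add]
  congr 2
  field_simp
  ring

lemma Hc_real (σ : ℝ) (hσ : 0 < σ) (l : ℝ → ℝ) (θ : ℝ) :
    Hc σ l θ = (smooth σ l θ : ℝ) := by
  have h1 : smooth σ l θ = ∫ u, l u * gaussPDF σ (θ - u) := by
    unfold smooth
    rw [← integral_sub_left_eq_self (fun u => l u * gaussPDF σ (θ - u)) volume θ]
    simp
  rw [h1, Hc, Jc, ← integral_const_mul, ← integral_complex_ofReal]
  congr 1
  funext u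
  rw [← gauss_shift σ hσ]
  push_cast
  ring

lemma int_abs (σ : ℝ) (hσ : 0 < σ) : Integrable (fun u => |u| * gaussPDF σ u) := by
  refine (int_exp σ hσ 1).mono' (Continuous.mul (by fun_prop) (gauss_cont σ)).aestronglyMeasurable
    (Filter.Eventually.of_forall fun u => ?_)
  have := gauss_pos σ hσ u
  rw [Real.norm_eq_abs, abs_of_nonneg (by positivity), one_mul]
  gcongr
  linarith [Real.add_one_le_exp |u|]

lemma int_gauss (σ : ℝ) (hσ : 0 < σ) : Integrable (gaussPDF σ) := by
  simpa using int_exp σ hσ 0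

lemma Hc_bound (σ : ℝ) (hσ : 0 < σ) {l : ℝ → ℝ} (hl : LipschitzWith 1 l) (h0 : l 0 = 0) (z : ℂ) :
    ‖Hc σ l z‖ ≤ exp (‖z‖ ^ 2 / (2 * σ ^ 2)) * (‖z‖ + ∫ u, |u| * gaussPDF σ u) := by
  have hI : Integrable (fun u => |z.re| * gaussPDF σ u + |u| * gaussPDF σ u) :=
    ((int_gauss σ hσ).const_mul _).add (int_abs σ hσ)
  have hI' := hI.comp_sub_left z.re
  have hpre : ‖Complex.exp (-z ^ 2 / (2 * σ ^ 2))‖ =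
      exp (z.im ^ 2 / (2 * σ ^ 2)) * exp (-z.re ^ 2 / (2 * σ ^ 2)) := by
    rw [Complex.norm_exp, ← Real.exp_add]
    congr 1
    have : -z ^ 2 / (2 * σ ^ 2) = -z ^ 2 * ((1 / (2 * σ ^ 2) : ℝ) : ℂ) := by push_cast; ring
    rw [this, Complex.re_mul_ofReal, Complex.neg_re, sq, Complex.mul_re]; ring
  have him : z.im ^ 2 ≤ ‖z‖ ^ 2 := by
    rw [← sq_abs z.im]; gcongr; exact Complex.abs_im_le_norm z
  rw [Hc, norm_mul, hpre, mul_assoc]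
  gcongr
  rw [Jc, ← Real.norm_of_nonneg (Real.exp_pos (-z.re ^ 2 / (2 * σ ^ 2))).le, ← Complex.norm_real,
    ← norm_mul, ← integral_const_mul]
  refine (norm_integral_le_of_norm_le hI' (Filter.Eventually.of_forall fun u => ?_)).trans ?_
  · have hp := gauss_pos σ hσ u
    rw [norm_mul, norm_mul, norm_kernel, Complex.norm_real, Complex.norm_real, norm_mul,
      Real.norm_of_nonneg (Real.exp_pos _).le, Real.norm_of_nonneg hp.le, Real.norm_eq_abs]
    have hp2 := gauss_pos σ hσ (z.re - u)
    calc _ = |l u| * gaussPDF σ (z.re - u) := by rw [← gauss_shift σ hσ]; ring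
      _ ≤ (|z.re| + |z.re - u|) * gaussPDF σ (z.re - u) := by
        gcongr
        refine (lip_abs hl h0 u).trans ?_
        have := abs_sub z.re (z.re - u)
        simpa using this
      _ = _ := by ring
  · rw [integral_sub_left_eq_self (fun u => |z.re| * gaussPDF σ u + |u| * gaussPDF σ u) volume z.re,
      integral_add ((int_gauss σ hσ).const_mul _) (int_abs σ hσ), integral_const_mul,
      gauss_total σ hσ, mul_one]
    gcongr
    exact Complex.abs_re_le_norm z

/-- polynomial approximation of the Gaussian-smoothed 1-Lipschitz
function `ℓ_σ(θ) - ℓ_σ(0)` by `e^{-θ} P_{k-1}(θ)`, with controlled coefficients. -/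
theorem stmt5 (θs σ : ℝ) (hθ : 0 < θs) (hσ : 0 < σ) :
    ∃ C > (0:ℝ),
    ∀ l : ℝ → ℝ, LipschitzWith 1 l → l 0 = 0 →
    ∀ k : ℕ, 1 ≤ k →
    ∃ c : ℕ → ℝ,
      (∀ x, x < k → |c x| ≤
        C * Real.sqrt (x + 1) * 2 ^ x * (1 + ((x : ℝ) / (Real.exp 1 * σ ^ 2)) ^ ((x : ℝ) / 2)) /
          (Nat.factorial x)) ∧
      ∀ θ ∈ Set.Icc (0:ℝ) θs,
        |smooth σ l θ - smooth σ l 0 - Real.exp (-θ) * ∑ x ∈ Finset.range k, c x * θ ^ x| ≤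
          C * Real.sqrt (k + 1) * (2 * θs) ^ k *
            (1 + ((k : ℝ) / (Real.exp 1 * σ ^ 2)) ^ ((k : ℝ) / 2)) / (Nat.factorial k) := by
  set E := ∫ u, |u| * gaussPDF σ u with hEdef
  have hE : 0 ≤ E := integral_nonneg fun u => mul_nonneg (abs_nonneg _) (gauss_pos σ hσ u).le
  obtain ⟨C, hC, hnum⟩ := numeric θs σ E hθ hσ hE
  refine ⟨C, hC, fun l hl h0 k hk => ?_⟩
  let f : ℂ → ℂ := fun z => Complex.exp z * (Hc σ l z - Hc σ l 0)
  have hf : Differentiable ℂ f := by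
    have := Hc_diff σ hσ hl h0
    fun_prop
  have hfb : ∀ r : ℝ, 0 < r → ∀ z : ℂ, ‖z‖ = r →
      ‖f z‖ ≤ exp r * (exp (r ^ 2 / (2 * σ ^ 2)) * (r + 2 * E)) := by
    intro r hr z hz
    have h1 := Hc_bound σ hσ hl h0 z
    have h2 := Hc_bound σ hσ hl h0 0
    rw [hz, ← hEdef] at h1
    simp only [norm_zero, ne_eq, OfNat.ofNat_ne_zero, not_false_eq_true, zero_pow, zero_div,
      Real.exp_zero, one_mul, zero_add, ← hEdef] at h2
    have h3 : 1 ≤ exp (r ^ 2 / (2 * σ ^ 2)) := Real.one_le_exp (by positivity)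
    have h4 : ‖Complex.exp z‖ ≤ exp r := by
      rw [Complex.norm_exp]
      exact Real.exp_le_exp.2 (hz ▸ Complex.re_le_norm z)
    calc ‖f z‖ = ‖Complex.exp z‖ * ‖Hc σ l z - Hc σ l 0‖ := norm_mul _ _
      _ ≤ exp r * (exp (r ^ 2 / (2 * σ ^ 2)) * (r + 2 * E)) := by
        gcongr
        refine (norm_sub_le _ _).trans ?_
        nlinarith
  refine ⟨fun n => (iteratedDeriv n f 0 / (Nat.factorial n)).re, ?_, ?_⟩
  · intro x _
    rcases Nat.eq_zero_or_pos x with rfl | hx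
    · have : (iteratedDeriv 0 f 0 / (Nat.factorial 0)).re = 0 := by simp [f]
      simp only [this, abs_zero]
      positivity
    · obtain ⟨r, hr, hr2, hle⟩ := hnum x hx
      obtain ⟨ha, -⟩ := taylor_tail f hf r _ hr (hfb r hr)
      refine (Complex.abs_re_le_norm _).trans ((ha x).trans (le_trans ?_ hle))
      refine div_le_div_of_nonneg_right ?_ (by positivity)
      have : 0 ≤ exp r * (exp (r ^ 2 / (2 * σ ^ 2)) * (r + 2 * E)) := by positivity
      linarith
  · intro θ hθm
    obtain ⟨r, hr, hr2, hle⟩ := hnum k hk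
    obtain ⟨-, hb⟩ := taylor_tail f hf r _ hr (hfb r hr)
    have hb := hb θs hθ.le hr2 (θ : ℂ)
      (by rw [Complex.norm_real, Real.norm_of_nonneg hθm.1]; exact hθm.2) k
    have hre := (Complex.abs_re_le_norm _).trans hb
    have hfθ : (f θ).re = exp θ * (smooth σ l θ - smooth σ l 0) := by
      have : f θ = ((exp θ * (smooth σ l θ - smooth σ l 0) : ℝ) : ℂ) := by
        have h00 := Hc_real σ hσ l 0
        rw [Complex.ofReal_zero] at h00
        simp only [f]
        rw [Hc_real σ hσ, h00]
        push_cast; rfl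
      rw [this, Complex.ofReal_re]
    rw [Complex.sub_re, Complex.re_sum, hfθ] at hre
    have hsum : ∑ n ∈ Finset.range k, (iteratedDeriv n f 0 / (Nat.factorial n) * (θ:ℂ) ^ n).re =
        ∑ n ∈ Finset.range k, (iteratedDeriv n f 0 / (Nat.factorial n)).re * θ ^ n := by
      refine Finset.sum_congr rfl fun n _ => ?_
      rw [← Complex.ofReal_pow, Complex.re_mul_ofReal]
    rw [hsum] at hre
    set S := ∑ n ∈ Finset.range k, (iteratedDeriv n f 0 / (Nat.factorial n)).re * θ ^ n
    have heq : smooth σ l θ - smooth σ l 0 - exp (-θ) * S =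
        exp (-θ) * (exp θ * (smooth σ l θ - smooth σ l 0) - S) := by
      rw [mul_sub, ← mul_assoc, ← Real.exp_add]; simp
    rw [heq, abs_mul, abs_of_pos (Real.exp_pos _)]
    have he : exp (-θ) ≤ 1 := Real.exp_le_one_iff.2 (by linarith [hθm.1])
    calc _ ≤ 1 * |exp θ * (smooth σ l θ - smooth σ l 0) - S| := by gcongr
      _ ≤ _ := by rw [one_mul]; exact hre
      _ ≤ _ := mul_le_mul_of_nonneg_right hle (by positivity)
      _ = _ := by rw [mul_pow]; ring
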